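/- Let j : ℝ² → ℝ³ be a smooth harmonic map (Δj = 0) and for λ > 0 define j^⊤(x) = j(x) − (j(x) · π_λ(x)) π_λ(x). Then for every λ > 0 and x ∈ ℝ²: Δ(j^⊤)(x) · ∂_λπ_λ(x) = −|∇π_λ(x)|² (j(x) · ∂_λπ_λ(x)) − λ⁻¹ [(x¹∂₁j(x) + x²∂₂j(x)) · π_λ(x)] |∇π_λ(x)|². -/

import Mathlib

noncomputable section

/-- The rescaled inverse stereographic projection `π_λ : ℝ² → ℝ³`. -/
def piL (lam : ℝ) (x : ℝ × ℝ) : Fin 3 → ℝ :=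
  ![2 * lam * x.1 / (1 + lam ^ 2 * (x.1 ^ 2 + x.2 ^ 2)),
    2 * lam * x.2 / (1 + lam ^ 2 * (x.1 ^ 2 + x.2 ^ 2)),
    (1 - lam ^ 2 * (x.1 ^ 2 + x.2 ^ 2)) / (1 + lam ^ 2 * (x.1 ^ 2 + x.2 ^ 2))]

/-- Euclidean dot product on ℝ³. -/
def dot3 (v w : Fin 3 → ℝ) : ℝ := v 0 * w 0 + v 1 * w 1 + v 2 * w 2

/-- First Euclidean partial derivative of an ℝ³-valued map on ℝ². -/
def pd1 (f : ℝ × ℝ → Fin 3 → ℝ) (x : ℝ × ℝ) : Fin 3 → ℝ := fderiv ℝ f x (1, 0)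

/-- Second Euclidean partial derivative of an ℝ³-valued map on ℝ². -/
def pd2 (f : ℝ × ℝ → Fin 3 → ℝ) (x : ℝ × ℝ) : Fin 3 → ℝ := fderiv ℝ f x (0, 1)

/-- The componentwise Euclidean Laplacian. -/
def lap (f : ℝ × ℝ → Fin 3 → ℝ) (x : ℝ × ℝ) : Fin 3 → ℝ := pd1 (pd1 f) x + pd2 (pd2 f) x

/-- First Euclidean partial derivative of a scalar function on ℝ². -/
def pds1 (f : ℝ × ℝ → ℝ) (x : ℝ × ℝ) : ℝ := fderiv ℝ f x (1, 0)

/-- Second Euclidean partial derivative of a scalar function on ℝ². -/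
def pds2 (f : ℝ × ℝ → ℝ) (x : ℝ × ℝ) : ℝ := fderiv ℝ f x (0, 1)

/-- The energy density `|∇f|² = |∂₁f|² + |∂₂f|²`. -/
def gradSq (f : ℝ × ℝ → Fin 3 → ℝ) (x : ℝ × ℝ) : ℝ :=
  dot3 (pd1 f x) (pd1 f x) + dot3 (pd2 f x) (pd2 f x)

/-- The derivative `∂_λ π_λ` with respect to the scale parameter. -/
def dlamPi (lam : ℝ) (x : ℝ × ℝ) : Fin 3 → ℝ := deriv (fun l => piL l x) lam

section Calculus

variable {E : Type*} [NormedAddCommGroup E] [NormedSpace ℝ E]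

lemma ContDiff.differentiable_fderiv_apply {F : Type*} [NormedAddCommGroup F] [NormedSpace ℝ F]
    {f : E → F} (hf : ContDiff ℝ 2 f) (v : E) : Differentiable ℝ (fun y => fderiv ℝ f y v) :=
  ((hf.fderiv_right (m := 1) (by norm_num)).differentiable (by norm_num)).clm_apply
    (differentiable_const v)

variable {F : Type*} [NormedAddCommGroup F] [NormedSpace ℝ F]

lemma fderiv_fderiv_sub_apply {f g : E → F} (hf : ContDiff ℝ 2 f) (hg : ContDiff ℝ 2 g)
    (x v : E) :
    fderiv ℝ (fun y => fderiv ℝ (fun z => f z - g z) y v) x v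
      = fderiv ℝ (fun y => fderiv ℝ f y v) x v - fderiv ℝ (fun y => fderiv ℝ g y v) x v := by
  have h : (fun y => fderiv ℝ (fun z => f z - g z) y v)
      = fun y => fderiv ℝ f y v - fderiv ℝ g y v := by
    funext y
    rw [fderiv_fun_sub (hf.differentiable (by norm_num) y) (hg.differentiable (by norm_num) y)]
    rfl
  rw [h, fderiv_fun_sub (hf.differentiable_fderiv_apply v x)
    (hg.differentiable_fderiv_apply v x)]
  rfl

lemma fderiv_fderiv_smul_apply {g : E → ℝ} {P : E → F} (hg : ContDiff ℝ 2 g)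
    (hP : ContDiff ℝ 2 P) (x v : E) :
    fderiv ℝ (fun y => fderiv ℝ (fun z => g z • P z) y v) x v
      = fderiv ℝ (fun y => fderiv ℝ g y v) x v • P x
        + (2 * fderiv ℝ g x v) • fderiv ℝ P x v
        + g x • fderiv ℝ (fun y => fderiv ℝ P y v) x v := by
  have dg := hg.differentiable (by norm_num)
  have dP := hP.differentiable (by norm_num)
  have ddg := hg.differentiable_fderiv_apply v
  have ddP := hP.differentiable_fderiv_apply v
  have h : (fun y => fderiv ℝ (fun z => g z • P z) y v)
      = fun y => g y • fderiv ℝ P y v + fderiv ℝ g y v • P y := by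
    funext y
    rw [fderiv_fun_smul (dg y) (dP y)]
    rfl
  rw [h, fderiv_fun_add ((dg x).fun_smul (ddP x)) ((ddg x).fun_smul (dP x)),
    fderiv_fun_smul (dg x) (ddP x), fderiv_fun_smul (ddg x) (dP x)]
  simp only [add_apply, smul_apply,
    ContinuousLinearMap.smulRight_apply]
  module

end Calculus

lemma lap_sub_smul {j P : ℝ × ℝ → Fin 3 → ℝ} {g : ℝ × ℝ → ℝ} (hj : ContDiff ℝ 2 j)
    (hg : ContDiff ℝ 2 g) (hP : ContDiff ℝ 2 P) (x : ℝ × ℝ) :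
    lap (fun y => j y - g y • P y) x
      = lap j x - ((pds1 (pds1 g) x + pds2 (pds2 g) x) • P x
        + (2 * pds1 g x) • pd1 P x + (2 * pds2 g x) • pd2 P x + g x • lap P x) := by
  have hs : ContDiff ℝ 2 (fun y => g y • P y) := hg.smul hP
  have h (v : ℝ × ℝ) := fderiv_fderiv_sub_apply hj hs x v
  simp only [fderiv_fderiv_smul_apply hg hP] at h
  have h₁ := h (1, 0)
  have h₂ := h (0, 1)
  change pd1 (pd1 _) x = pd1 (pd1 j) x - (pds1 (pds1 g) x • P x
    + (2 * pds1 g x) • pd1 P x + g x • pd1 (pd1 P) x) at h₁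
  change pd2 (pd2 _) x = pd2 (pd2 j) x - (pds2 (pds2 g) x • P x
    + (2 * pds2 g x) • pd2 P x + g x • pd2 (pd2 P) x) at h₂
  simp only [lap]
  rw [h₁, h₂]
  module

lemma contDiff_dot3 {j P : ℝ × ℝ → Fin 3 → ℝ} (hj : ContDiff ℝ 2 j) (hP : ContDiff ℝ 2 P) :
    ContDiff ℝ 2 (fun y => dot3 (j y) (P y)) := by
  have hj' := contDiff_pi.1 hj
  have hP' := contDiff_pi.1 hP
  exact (((hj' 0).mul (hP' 0)).add ((hj' 1).mul (hP' 1))).add ((hj' 2).mul (hP' 2))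

lemma fderiv_dot3_apply {j P : ℝ × ℝ → Fin 3 → ℝ} {x : ℝ × ℝ} (hj : DifferentiableAt ℝ j x)
    (hP : DifferentiableAt ℝ P x) (v : ℝ × ℝ) :
    fderiv ℝ (fun y => dot3 (j y) (P y)) x v
      = dot3 (fderiv ℝ j x v) (P x) + dot3 (j x) (fderiv ℝ P x v) := by
  have hj' := hasFDerivAt_pi'.1 hj.hasFDerivAt
  have hP' := hasFDerivAt_pi'.1 hP.hasFDerivAt
  have h := (((hj' 0).mul (hP' 0)).add ((hj' 1).mul (hP' 1))).add ((hj' 2).mul (hP' 2))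
  have e := congrArg (fun L => L v) h.fderiv
  refine Eq.trans e ?_
  simp only [add_apply, smul_apply,
    ContinuousLinearMap.comp_apply, ContinuousLinearMap.proj_apply, smul_eq_mul, dot3]
  ring

lemma pd1_eq_of_hasDerivAt {f : ℝ × ℝ → Fin 3 → ℝ} {x : ℝ × ℝ} {v : Fin 3 → ℝ}
    (hf : DifferentiableAt ℝ f x) (h : ∀ i, HasDerivAt (fun t => f (t, x.2) i) (v i) x.1) :
    pd1 f x = v :=
  (hf.hasFDerivAt.comp_hasDerivAt x.1
    ((hasDerivAt_id x.1).prodMk (hasDerivAt_const x.1 x.2))).unique (hasDerivAt_pi.2 h)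

lemma pd2_eq_of_hasDerivAt {f : ℝ × ℝ → Fin 3 → ℝ} {x : ℝ × ℝ} {v : Fin 3 → ℝ}
    (hf : DifferentiableAt ℝ f x) (h : ∀ i, HasDerivAt (fun t => f (x.1, t) i) (v i) x.2) :
    pd2 f x = v :=
  (hf.hasFDerivAt.comp_hasDerivAt x.2
    ((hasDerivAt_const x.2 x.1).prodMk (hasDerivAt_id x.2))).unique (hasDerivAt_pi.2 h)

section Stereographic

variable (lam : ℝ) (x : ℝ × ℝ)

/-- The conformal denominator `1 + λ²|x|²` of `piL`. -/
def piDenom : ℝ := 1 + lam ^ 2 * (x.1 ^ 2 + x.2 ^ 2)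

lemma piDenom_pos : 0 < piDenom lam x := by
  unfold piDenom
  positivity

lemma contDiff_piDenom : ContDiff ℝ 2 (piDenom lam) := by
  unfold piDenom
  fun_prop

lemma contDiff_piL : ContDiff ℝ 2 (piL lam) := by
  refine contDiff_pi.2 fun i => ?_
  have hD := contDiff_piDenom lam
  have h0 y := (piDenom_pos lam y).ne'
  fin_cases i
  · exact ContDiff.div (by fun_prop) hD h0
  · exact ContDiff.div (by fun_prop) hD h0
  · exact ContDiff.div (by fun_prop) hD h0

lemma hasDerivAt_piDenom_fst : HasDerivAt (fun t => piDenom lam (t, x.2))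
    (lam ^ 2 * (2 * x.1)) x.1 := by
  have := ((((hasDerivAt_id x.1).pow 2).add_const (x.2 ^ 2)).const_mul (lam ^ 2)).const_add 1
  exact this.congr_deriv (by simp)

lemma hasDerivAt_piDenom_snd : HasDerivAt (fun t => piDenom lam (x.1, t))
    (lam ^ 2 * (2 * x.2)) x.2 := by
  have := ((((hasDerivAt_id x.2).pow 2).const_add (x.1 ^ 2)).const_mul (lam ^ 2)).const_add 1
  exact this.congr_deriv (by simp)

lemma hasDerivAt_piDenom_scale : HasDerivAt (fun l => piDenom l x)
    (2 * lam * (x.1 ^ 2 + x.2 ^ 2)) lam := by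
  have := (((hasDerivAt_id lam).pow 2).mul_const (x.1 ^ 2 + x.2 ^ 2)).const_add 1
  exact this.congr_deriv (by simp)

lemma piL_eq : piL lam x = ![2 * lam * x.1 / piDenom lam x, 2 * lam * x.2 / piDenom lam x,
    (2 - piDenom lam x) / piDenom lam x] := by
  simp only [piL, piDenom]
  congr 4
  ring

lemma pd1_piL : pd1 (piL lam) x = ![
    2 * lam * (piDenom lam x - 2 * lam ^ 2 * x.1 ^ 2) / piDenom lam x ^ 2,
    -4 * lam ^ 3 * x.1 * x.2 / piDenom lam x ^ 2, -4 * lam ^ 2 * x.1 / piDenom lam x ^ 2] := by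
  refine pd1_eq_of_hasDerivAt ((contDiff_piL lam).differentiable (by norm_num) x) fun i => ?_
  have hD := hasDerivAt_piDenom_fst lam x
  have h0 := (piDenom_pos lam x).ne'
  simp only [piL_eq]
  fin_cases i
  · refine (((hasDerivAt_id x.1).const_mul (2 * lam)).div hD h0).congr_deriv ?_
    simp; ring
  · refine ((hasDerivAt_const x.1 (2 * lam * x.2)).div hD h0).congr_deriv ?_
    simp; ring
  · refine ((hD.const_sub 2).div hD h0).congr_deriv ?_
    simp; ring

lemma pd2_piL : pd2 (piL lam) x = ![-4 * lam ^ 3 * x.1 * x.2 / piDenom lam x ^ 2,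
    2 * lam * (piDenom lam x - 2 * lam ^ 2 * x.2 ^ 2) / piDenom lam x ^ 2,
    -4 * lam ^ 2 * x.2 / piDenom lam x ^ 2] := by
  refine pd2_eq_of_hasDerivAt ((contDiff_piL lam).differentiable (by norm_num) x) fun i => ?_
  have hD := hasDerivAt_piDenom_snd lam x
  have h0 := (piDenom_pos lam x).ne'
  simp only [piL_eq]
  fin_cases i
  · refine ((hasDerivAt_const x.2 (2 * lam * x.1)).div hD h0).congr_deriv ?_
    simp; ring
  · refine (((hasDerivAt_id x.2).const_mul (2 * lam)).div hD h0).congr_deriv ?_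
    simp; ring
  · refine ((hD.const_sub 2).div hD h0).congr_deriv ?_
    simp; ring

lemma dlamPi_eq : dlamPi lam x = ![2 * x.1 * (2 - piDenom lam x) / piDenom lam x ^ 2,
    2 * x.2 * (2 - piDenom lam x) / piDenom lam x ^ 2,
    -4 * lam * (x.1 ^ 2 + x.2 ^ 2) / piDenom lam x ^ 2] := by
  have hD := hasDerivAt_piDenom_scale lam x
  have h0 := (piDenom_pos lam x).ne'
  refine HasDerivAt.deriv (hasDerivAt_pi.2 fun i => ?_)
  simp only [piL_eq]
  fin_cases i
  · refine ((((hasDerivAt_id lam).const_mul 2).mul_const x.1).div hD h0).congr_deriv ?_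
    simp [piDenom]; ring
  · refine ((((hasDerivAt_id lam).const_mul 2).mul_const x.2).div hD h0).congr_deriv ?_
    simp [piDenom]; ring
  · refine ((hD.const_sub 2).div hD h0).congr_deriv ?_
    simp; ring

lemma pd1_pd1_piL : pd1 (pd1 (piL lam)) x = ![
    (-12 * lam ^ 3 * x.1 * piDenom lam x + 16 * lam ^ 5 * x.1 ^ 3) / piDenom lam x ^ 3,
    (-4 * lam ^ 3 * x.2 * piDenom lam x + 16 * lam ^ 5 * x.1 ^ 2 * x.2) / piDenom lam x ^ 3,
    (-4 * lam ^ 2 * piDenom lam x + 16 * lam ^ 4 * x.1 ^ 2) / piDenom lam x ^ 3] := by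
  refine pd1_eq_of_hasDerivAt ((contDiff_piL lam).differentiable_fderiv_apply _ x) fun i => ?_
  have hD := hasDerivAt_piDenom_fst lam x
  have h0 := (piDenom_pos lam x).ne'
  have hsq : piDenom lam x ^ 2 ≠ 0 := pow_ne_zero 2 h0
  have hid := hasDerivAt_id x.1
  simp only [pd1_piL]
  fin_cases i
  · refine (((hD.sub ((hid.pow 2).const_mul (2 * lam ^ 2))).const_mul (2 * lam)).div
      (hD.pow 2) hsq).congr_deriv ?_
    simp; field_simp; ring
  · refine (((hid.const_mul (-4 * lam ^ 3)).mul_const x.2).div (hD.pow 2) hsq).congr_deriv ?_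
    simp; field_simp; ring
  · refine ((hid.const_mul (-4 * lam ^ 2)).div (hD.pow 2) hsq).congr_deriv ?_
    simp; field_simp; ring

lemma pd2_pd2_piL : pd2 (pd2 (piL lam)) x = ![
    (-4 * lam ^ 3 * x.1 * piDenom lam x + 16 * lam ^ 5 * x.1 * x.2 ^ 2) / piDenom lam x ^ 3,
    (-12 * lam ^ 3 * x.2 * piDenom lam x + 16 * lam ^ 5 * x.2 ^ 3) / piDenom lam x ^ 3,
    (-4 * lam ^ 2 * piDenom lam x + 16 * lam ^ 4 * x.2 ^ 2) / piDenom lam x ^ 3] := by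
  refine pd2_eq_of_hasDerivAt ((contDiff_piL lam).differentiable_fderiv_apply _ x) fun i => ?_
  have hD := hasDerivAt_piDenom_snd lam x
  have h0 := (piDenom_pos lam x).ne'
  have hsq : piDenom lam x ^ 2 ≠ 0 := pow_ne_zero 2 h0
  have hid := hasDerivAt_id x.2
  simp only [pd2_piL]
  fin_cases i
  · refine ((hid.const_mul (-4 * lam ^ 3 * x.1)).div (hD.pow 2) hsq).congr_deriv ?_
    simp; field_simp; ring
  · refine (((hD.sub ((hid.pow 2).const_mul (2 * lam ^ 2))).const_mul (2 * lam)).div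
      (hD.pow 2) hsq).congr_deriv ?_
    simp; field_simp; ring
  · refine ((hid.const_mul (-4 * lam ^ 2)).div (hD.pow 2) hsq).congr_deriv ?_
    simp; field_simp; ring

/-- `π_λ` is a harmonic map into the sphere. -/
lemma lap_piL : lap (piL lam) x = (-8 * lam ^ 2 / piDenom lam x ^ 2) • piL lam x := by
  have h0 := (piDenom_pos lam x).ne'
  rw [lap, pd1_pd1_piL, pd2_pd2_piL, piL_eq]
  ext i
  fin_cases i <;> simp <;> field_simp <;> simp only [piDenom] <;> ring

lemma gradSq_piL : gradSq (piL lam) x = 8 * lam ^ 2 / piDenom lam x ^ 2 := by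
  have h0 := (piDenom_pos lam x).ne'
  rw [gradSq, pd1_piL, pd2_piL]
  simp [dot3]
  field_simp
  simp only [piDenom]
  ring

lemma dot3_piL_dlamPi : dot3 (piL lam x) (dlamPi lam x) = 0 := by
  have h0 := (piDenom_pos lam x).ne'
  rw [piL_eq, dlamPi_eq]
  simp [dot3]
  field_simp
  simp only [piDenom]
  ring

variable {lam}

/-- `∂_λ π_λ` is `λ⁻¹` times the radial derivative of `π_λ`. -/
lemma dlamPi_eq_radial (hlam : lam ≠ 0) :
    dlamPi lam x = lam⁻¹ • (x.1 • pd1 (piL lam) x + x.2 • pd2 (piL lam) x) := by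
  have h0 := (piDenom_pos lam x).ne'
  rw [dlamPi_eq, pd1_piL, pd2_piL]
  ext i
  fin_cases i
  · simp; field_simp; simp only [piDenom]; ring
  · simp; field_simp; simp only [piDenom]; ring
  · simp; field_simp; ring

lemma dot3_pd1_piL_dlamPi (hlam : lam ≠ 0) :
    dot3 (pd1 (piL lam) x) (dlamPi lam x) = lam⁻¹ * x.1 * gradSq (piL lam) x / 2 := by
  have h0 := (piDenom_pos lam x).ne'
  rw [pd1_piL, dlamPi_eq, gradSq_piL]
  simp [dot3]
  field_simp
  simp only [piDenom]
  ring

lemma dot3_pd2_piL_dlamPi (hlam : lam ≠ 0) :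
    dot3 (pd2 (piL lam) x) (dlamPi lam x) = lam⁻¹ * x.2 * gradSq (piL lam) x / 2 := by
  have h0 := (piDenom_pos lam x).ne'
  rw [pd2_piL, dlamPi_eq, gradSq_piL]
  simp [dot3]
  field_simp
  simp only [piDenom]
  ring

end Stereographic

/-- `Δ(j^⊤) · ∂_λπ_λ = −|∇π_λ|² (j·∂_λπ_λ) − λ⁻¹ [(xⁱ∂ᵢj)·π_λ] |∇π_λ|²`
for a smooth harmonic `j : ℝ² → ℝ³`, where `j^⊤ = j − (j·π_λ)π_λ`. -/
theorem stmt9 (j : ℝ × ℝ → Fin 3 → ℝ) (hj : ContDiff ℝ (⊤ : ℕ∞) j)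
    (hharm : ∀ y, lap j y = 0)
    (lam : ℝ) (hlam : 0 < lam) (x : ℝ × ℝ) :
    dot3 (lap (fun y => j y - dot3 (j y) (piL lam y) • piL lam y) x) (dlamPi lam x)
      = -(gradSq (piL lam) x) * dot3 (j x) (dlamPi lam x)
        - lam⁻¹ * dot3 (x.1 • pd1 j x + x.2 • pd2 j x) (piL lam x) * gradSq (piL lam) x := by
  have hj2 : ContDiff ℝ 2 j := contDiff_infty.1 hj 2
  have hP := contDiff_piL lam
  have dj := hj2.differentiable (by norm_num) x
  have dP := hP.differentiable (by norm_num) x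
  have e₁ : pds1 (fun y => dot3 (j y) (piL lam y)) x
      = dot3 (pd1 j x) (piL lam x) + dot3 (j x) (pd1 (piL lam) x) :=
    fderiv_dot3_apply dj dP (1, 0)
  have e₂ : pds2 (fun y => dot3 (j y) (piL lam y)) x
      = dot3 (pd2 j x) (piL lam x) + dot3 (j x) (pd2 (piL lam) x) :=
    fderiv_dot3_apply dj dP (0, 1)
  have hp := dot3_piL_dlamPi lam x
  have h₁ := dot3_pd1_piL_dlamPi x hlam.ne'
  have h₂ := dot3_pd2_piL_dlamPi x hlam.ne'
  have hrad : dot3 (j x) (dlamPi lam x) = lam⁻¹ * (x.1 * dot3 (j x) (pd1 (piL lam) x)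
      + x.2 * dot3 (j x) (pd2 (piL lam) x)) := by
    rw [dlamPi_eq_radial x hlam.ne']
    simp only [dot3, Pi.add_apply, Pi.smul_apply, smul_eq_mul]
    ring
  rw [lap_sub_smul hj2 (contDiff_dot3 hj2 hP) hP, hharm, lap_piL, e₁, e₂, hrad]
  generalize pds1 (pds1 _) x + pds2 (pds2 _) x = a
  generalize -8 * lam ^ 2 / piDenom lam x ^ 2 = b
  simp only [dot3, Pi.add_apply, Pi.sub_apply, Pi.zero_apply, Pi.smul_apply, smul_eq_mul]
    at hp h₁ h₂ ⊢
  linear_combination (norm := (simp only [dot3]; ring))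
    (-(a + b * dot3 (j x) (piL lam x))) * hp
      - 2 * (dot3 (pd1 j x) (piL lam x) + dot3 (j x) (pd1 (piL lam) x)) * h₁
      - 2 * (dot3 (pd2 j x) (piL lam x) + dot3 (j x) (pd2 (piL lam) x)) * h₂
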